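/- arXiv:1903.01055 — 2 statements merged into one kernel-verified Lean document; each statement's English description precedes it below -/
import Mathlib

section
/- The (n_x+1)×(n_x+1) matrix Ẑ is invertible, and consequently the matrix Ĥ := Ẑᵀ diag(Q, r) Ẑ is symmetric positive definite. -/
open Matrix

/-- The controllability matrix `[b, Ab, …, A^{n_x−1}b]`. -/
def ctrbMat {nx : ℕ} (A : Matrix (Fin nx) (Fin nx) ℝ) (b : Fin nx → ℝ) :
    Matrix (Fin nx) (Fin nx) ℝ :=
  Matrix.of fun i j => ((A ^ (j : ℕ)) *ᵥ b) i

/-- The matrix `Ẑ`: its `j`-th column (0-based, for `j < n_x`) is `(x̄_{n_x−j}, ū_{n_x−j})`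
and its last column is `(0,…,0,1)`. -/
def Zhat (nx : ℕ) (xb : ℕ → Fin nx → ℝ) (ub : ℕ → ℝ) :
    Matrix (Fin (nx + 1)) (Fin (nx + 1)) ℝ :=
  fun p j =>
    if _hj : (j : ℕ) < nx then
      if hp : (p : ℕ) < nx then xb (nx - j) ⟨p, hp⟩ else ub (nx - j)
    else
      if (p : ℕ) < nx then 0 else 1

/-- The block-diagonal matrix `diag(Q, r)` of size `(n_x+1)×(n_x+1)`. -/
def diagQr (nx : ℕ) (Q : Matrix (Fin nx) (Fin nx) ℝ) (r : ℝ) :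
    Matrix (Fin (nx + 1)) (Fin (nx + 1)) ℝ :=
  fun p q =>
    if hp : (p : ℕ) < nx then
      if hq : (q : ℕ) < nx then Q ⟨p, hp⟩ ⟨q, hq⟩ else 0
    else
      if (q : ℕ) < nx then 0 else r

/-- The solution of `x (i + 1) = A x i + u i b` with `x 0 = 0` is the discrete convolution of `u`
with the Krylov sequence `A ^ l b`. -/
theorem linearRecurrence_eq_sum {n : ℕ} (A : Matrix (Fin n) (Fin n) ℝ) (b : Fin n → ℝ)
    (x : ℕ → Fin n → ℝ) (u : ℕ → ℝ) (N : ℕ) (h0 : x 0 = 0)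
    (hrec : ∀ i ≤ N, x (i + 1) = A *ᵥ x i + u i • b) :
    ∀ k ≤ N, x (k + 1) = ∑ l ∈ Finset.range (k + 1), u (k - l) • ((A ^ l) *ᵥ b) := by
  intro k
  induction k with
  | zero => intro h; simp [hrec 0 h, h0]
  | succ k ih =>
    intro h
    rw [hrec _ h, ih (by omega), Finset.sum_range_succ' _ (k + 1), mulVec_sum]
    simp [mulVec_smul, pow_succ', mulVec_mulVec]

/-- If `(A, b)` is controllable, the states reached from the origin with a first input equal to `1`
form an invertible matrix. -/
theorem isUnit_states {n : ℕ} (A : Matrix (Fin n) (Fin n) ℝ) (b : Fin n → ℝ)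
    (hctrb : IsUnit (ctrbMat A b)) (x : ℕ → Fin n → ℝ) (u : ℕ → ℝ) (h0 : x 0 = 0) (hu : u 0 = 1)
    (hrec : ∀ i ≤ n, x (i + 1) = A *ᵥ x i + u i • b) :
    IsUnit (Matrix.of fun i j : Fin n => x (j + 1) i) := by
  let T : Matrix (Fin n) (Fin n) ℝ := Matrix.of fun l j => if l ≤ j then u (j - l : ℕ) else 0
  have hT : IsUnit T := by
    rw [isUnit_iff_isUnit_det, det_of_isUpperTriangular]
    · simp [T, hu]
    · intro i j hij
      have hij' : j < i := hij
      simp [T, hij']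
  have hmul : (Matrix.of fun i j : Fin n => x (j + 1) i) = ctrbMat A b * T := by
    ext i j
    have hsub : Finset.range ((j : ℕ) + 1) ⊆ Finset.range n :=
      Finset.range_subset_range.2 (by omega)
    have hsum : ∑ l ∈ Finset.range n,
        (if l ≤ (j : ℕ) then u (j - l) * ((A ^ l) *ᵥ b) i else 0) =
        ∑ l ∈ Finset.range ((j : ℕ) + 1), u (j - l) * ((A ^ l) *ᵥ b) i := by
      rw [← Finset.sum_subset hsub]
      · refine Finset.sum_congr rfl fun l hl => if_pos ?_
        exact Nat.lt_succ_iff.1 (Finset.mem_range.1 hl)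
      · intro l _ hl
        refine if_neg fun hlj => hl (Finset.mem_range.2 (by omega))
    rw [of_apply, linearRecurrence_eq_sum A b x u n h0 hrec j j.2.le, mul_apply,
      Finset.sum_apply]
    simp only [Pi.smul_apply, smul_eq_mul]
    rw [← hsum, Finset.sum_range]
    refine Finset.sum_congr rfl fun l _ => ?_
    by_cases h : l ≤ j
    · simp [T, ctrbMat, mul_comm, h]
    · simp [T, ctrbMat, h]
  rw [hmul]
  exact hctrb.mul hT

/-- `Ẑ` is invertible as soon as its states `x̄_1, …, x̄_{n_x}` form an invertible matrix. -/
theorem isUnit_Zhat {n : ℕ} (x : ℕ → Fin n → ℝ) (u : ℕ → ℝ)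
    (hX : IsUnit (Matrix.of fun i j : Fin n => x (j + 1) i)) : IsUnit (Zhat n x u) := by
  rw [← mulVec_injective_iff_isUnit] at hX ⊢
  refine (injective_iff_map_eq_zero (Zhat n x u).mulVecLin).2 fun w hw => ?_
  have hrow (p) : (Zhat n x u *ᵥ w) p = 0 := congrFun hw p
  have hrev : (fun j : Fin n => w j.rev.castSucc) = 0 := by
    refine hX ?_
    ext p
    have hp := hrow p.castSucc
    simp only [mulVec, dotProduct, Fin.sum_univ_castSucc, Zhat] at hp
    simp only [mulVec, dotProduct, of_apply, Pi.zero_apply, mul_zero, Finset.sum_const_zero]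
    rw [← Equiv.sum_comp Fin.revPerm]
    simp only [Fin.revPerm_apply, Fin.rev_rev]
    simp only [Fin.val_castSucc, Fin.is_lt, Fin.val_last, lt_irrefl, dite_true, dite_false, if_true,
      zero_mul, add_zero] at hp
    rw [← hp]
    refine Finset.sum_congr rfl fun j _ => ?_
    rw [Fin.val_rev, show n - ((j : ℕ) + 1) + 1 = n - j by omega]
  have hcast (j : Fin n) : w j.castSucc = 0 := by simpa using congrFun hrev j.rev
  ext j
  refine Fin.lastCases ?_ hcast j
  simpa [mulVec, dotProduct, Fin.sum_univ_castSucc, Zhat, hcast] using hrow (Fin.last n)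

theorem posDef_diagQr {n : ℕ} {Q : Matrix (Fin n) (Fin n) ℝ} (hQ : Q.PosDef) {r : ℝ}
    (hr : 0 < r) : (diagQr n Q r).PosDef := by
  refine PosDef.of_dotProduct_mulVec_pos ?_ fun w hw => ?_
  · ext i j
    have hsymm (a b) : Q b a = Q a b := by simpa using hQ.isHermitian.apply a b
    refine Fin.lastCases ?_ (fun i => ?_) i <;> refine Fin.lastCases ?_ (fun j => ?_) j <;>
      simp [diagQr, hsymm]
  · have hform : star w ⬝ᵥ (diagQr n Q r *ᵥ w) =
        star (fun i : Fin n => w i.castSucc) ⬝ᵥ (Q *ᵥ fun i : Fin n => w i.castSucc) +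
          r * w (Fin.last n) ^ 2 := by
      simp [mulVec, dotProduct, Fin.sum_univ_castSucc, diagQr]
      ring
    rw [hform]
    by_cases hv : (fun i : Fin n => w i.castSucc) = 0
    · have hl : w (Fin.last n) ≠ 0 := by
        intro hl
        refine hw (funext fun j => ?_)
        exact Fin.lastCases hl (fun i => congrFun hv i) j
      rw [hv]
      simp only [mulVec_zero, dotProduct_zero, zero_add]
      positivity
    · have := hQ.dotProduct_mulVec_pos hv
      positivity

/-- the matrix `Ẑ` is invertible, and consequently
`Ĥ = Ẑᵀ diag(Q,r) Ẑ` is symmetric positive definite. -/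
theorem Zhat_isUnit_and_Hhat_posDef
    (nx : ℕ) (hnx : 1 ≤ nx)
    (A : Matrix (Fin nx) (Fin nx) ℝ) (b : Fin nx → ℝ) (hctrb : IsUnit (ctrbMat A b))
    (Q : Matrix (Fin nx) (Fin nx) ℝ) (hQ : Q.PosDef) (r : ℝ) (hr : 0 < r)
    (xb : ℕ → Fin nx → ℝ) (ub : ℕ → ℝ)
    (hxb0 : xb 0 = 0) (hub0 : ub 0 = 1)
    (hrec : ∀ i ≤ nx, xb (i + 1) = A *ᵥ xb i + ub i • b)
    (hend : xb (nx + 1) = 0) :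
    IsUnit (Zhat nx xb ub) ∧
    ((Zhat nx xb ub)ᵀ * diagQr nx Q r * Zhat nx xb ub).PosDef := by
  have hZ : IsUnit (Zhat nx xb ub) :=
    isUnit_Zhat xb ub (isUnit_states A b hctrb xb ub hxb0 hub0 hrec)
  refine ⟨hZ, ?_⟩
  have hpos := (posDef_diagQr hQ hr).conjTranspose_mul_mul_same
    (mulVec_injective_iff_isUnit.2 hZ)
  rwa [conjTranspose_eq_transpose_of_trivial] at hpos
end

section
/- (Uniform exponential off-diagonal decay of the inverse reduced Hessian.) There exist constants C > 0 and ρ ∈ [0,1), depending only on n_x, A, b, Q, r (and not on N), such that for every integer N ≥ 2 the matrix ZᵀHZ is invertible and for all j, k ∈ {1,…,N−1}: |((ZᵀHZ)^{-1})_{j,k}| ≤ C ρ^{|j−k|}. -/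
open Matrix

/-- The input entries of the `j`-th column of `Z` (0-based): `ū_{i−j}` for
`j ≤ i ≤ j + n_x`, and `0` otherwise. -/
def colU (ub : ℕ → ℝ) (nx j : ℕ) : ℕ → ℝ :=
  fun i => if j ≤ i ∧ i ≤ j + nx then ub (i - j) else 0

/-- The state trajectory generated from the zero initial state by the input
sequence `u` through the dynamics `x⁺ = Ax + bu`. -/
def traj {nx : ℕ} (A : Matrix (Fin nx) (Fin nx) ℝ) (b : Fin nx → ℝ) (u : ℕ → ℝ) :
    ℕ → Fin nx → ℝ
  | 0 => 0
  | i + 1 => A *ᵥ traj A b u i + u i • b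

/-- The null-space basis matrix `Z` (0-based indexing of times `0,…,N−1` for states and
`0,…,N−2` for inputs; the stacked-vector index type is `(Fin N × Fin nx) ⊕ Fin (N−1)`). -/
def Zmat (N nx : ℕ) (A : Matrix (Fin nx) (Fin nx) ℝ) (b : Fin nx → ℝ) (ub : ℕ → ℝ) :
    Matrix ((Fin N × Fin nx) ⊕ Fin (N - 1)) (Fin (N - 1)) ℝ :=
  fun p j =>
    match p with
    | Sum.inl (i, a) => traj A b (colU ub nx (j : ℕ)) (i : ℕ) a
    | Sum.inr i => colU ub nx (j : ℕ) (i : ℕ)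

/-- The block-diagonal Hessian `H = diag(Q, r, …, Q, r, 0)`. -/
def Hmat (N nx : ℕ) (Q : Matrix (Fin nx) (Fin nx) ℝ) (r : ℝ) :
    Matrix ((Fin N × Fin nx) ⊕ Fin (N - 1)) ((Fin N × Fin nx) ⊕ Fin (N - 1)) ℝ :=
  fun p q =>
    match p, q with
    | Sum.inl (i, a), Sum.inl (i', a') =>
        if i = i' ∧ (i : ℕ) + 1 < N then Q a a' else 0
    | Sum.inr j, Sum.inr j' => if j = j' then r else 0
    | _, _ => 0

/-- The number of indices within distance `w` of a given one is at most `2 * w + 1`. -/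
lemma card_filter_natAbs_sub_le {n : ℕ} (w : ℕ) (i : Fin n) :
    (Finset.univ.filter fun j : Fin n => (((i : ℕ) : ℤ) - ((j : ℕ) : ℤ)).natAbs ≤ w).card
      ≤ 2 * w + 1 := by
  calc _ ≤ (Finset.Icc ((i : ℕ) - w) ((i : ℕ) + w)).card := by
        refine Finset.card_le_card_of_injOn (fun j : Fin n => (j : ℕ)) ?_ ?_
        · intro j hj
          simp only [Finset.coe_filter, Finset.mem_univ, true_and, Set.mem_ofPred_eq] at hj
          simp only [Finset.coe_Icc, Set.mem_Icc]
          omega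
        · intro a _ b _ hab
          exact Fin.ext hab
    _ ≤ 2 * w + 1 := by
        rw [Nat.card_Icc]
        omega

/-- Schur-type bound for a banded sum of products. -/
lemma sum_band_abs_mul_abs_le {n : ℕ} (w : ℕ) (y : Fin n → ℝ) :
    ∑ i : Fin n, ∑ j : Fin n, (if (((i : ℕ) : ℤ) - ((j : ℕ) : ℤ)).natAbs ≤ w then |y i| * |y j| else 0)
      ≤ (2 * w + 1) * ∑ i, y i ^ 2 := by
  have count : ∀ i : Fin n,
      ∑ j : Fin n, (if (((i : ℕ) : ℤ) - ((j : ℕ) : ℤ)).natAbs ≤ w then y i ^ 2 else 0)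
        ≤ (2 * w + 1) * y i ^ 2 := by
    intro i
    rw [← Finset.sum_filter, Finset.sum_const, nsmul_eq_mul]
    gcongr
    exact_mod_cast card_filter_natAbs_sub_le w i
  have half : ∑ i : Fin n, ∑ j : Fin n,
      (if (((i : ℕ) : ℤ) - ((j : ℕ) : ℤ)).natAbs ≤ w then y i ^ 2 else 0)
        ≤ (2 * w + 1) * ∑ i, y i ^ 2 := by
    rw [Finset.mul_sum]
    exact Finset.sum_le_sum fun i _ => count i
  have half' : ∑ i : Fin n, ∑ j : Fin n,
      (if (((i : ℕ) : ℤ) - ((j : ℕ) : ℤ)).natAbs ≤ w then y j ^ 2 else 0)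
        ≤ (2 * w + 1) * ∑ i, y i ^ 2 := by
    rw [Finset.sum_comm]
    refine le_trans (le_of_eq ?_) half
    refine Finset.sum_congr rfl fun i _ => Finset.sum_congr rfl fun j _ => ?_
    rw [← Int.natAbs_neg, neg_sub]
  have key : ∑ i : Fin n, ∑ j : Fin n,
      (if (((i : ℕ) : ℤ) - ((j : ℕ) : ℤ)).natAbs ≤ w then |y i| * |y j| else 0)
      ≤ ∑ i : Fin n, ∑ j : Fin n,
        ((if (((i : ℕ) : ℤ) - ((j : ℕ) : ℤ)).natAbs ≤ w then y i ^ 2 else 0) / 2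
        + (if (((i : ℕ) : ℤ) - ((j : ℕ) : ℤ)).natAbs ≤ w then y j ^ 2 else 0) / 2) := by
    refine Finset.sum_le_sum fun i _ => Finset.sum_le_sum fun j _ => ?_
    split_ifs
    · nlinarith [sq_nonneg (|y i| - |y j|), sq_abs (y i), sq_abs (y j)]
    · simp
  simp only [Finset.sum_add_distrib, ← Finset.sum_div] at key
  linarith

lemma abs_sub_le_of_le_mul {a b t : ℝ} (ha : 0 ≤ a) (hb : 0 ≤ b) (h₁ : a ≤ t * b)
    (h₂ : b ≤ t * a) : |a - b| ≤ (t - 1) * b := by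
  rw [abs_le]
  constructor
  · rcases le_total 2 t with h | h
    · nlinarith
    · nlinarith [mul_le_mul_of_nonneg_left h₂ (sub_nonneg.2 h), mul_nonneg ha (sq_nonneg (t - 1))]
  · linarith

lemma isUnit_of_coercive {n : ℕ} {M : Matrix (Fin n) (Fin n) ℝ} {c : ℝ} (hc : 0 < c)
    (hM : ∀ v : Fin n → ℝ, c * ∑ i, v i ^ 2 ≤ v ⬝ᵥ (M *ᵥ v)) : IsUnit M := by
  rw [← Matrix.mulVec_injective_iff_isUnit]
  refine (injective_iff_map_eq_zero M.mulVecLin).2 fun v hv => ?_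
  rw [Matrix.mulVecLin_apply] at hv
  have h := hM v
  rw [hv, dotProduct_zero] at h
  have h0 : ∑ i, v i ^ 2 = 0 :=
    le_antisymm (by nlinarith) (Finset.sum_nonneg fun i _ => sq_nonneg _)
  ext i
  exact pow_eq_zero_iff two_ne_zero |>.1
    ((Finset.sum_eq_zero_iff_of_nonneg fun i _ => sq_nonneg (v i)).1 h0 i (Finset.mem_univ i))

/-- Exponential decay of the inverse of a coercive banded matrix (Combes–Thomas argument). -/
lemma abs_inv_le_of_coercive_of_banded {n w : ℕ} {M : Matrix (Fin n) (Fin n) ℝ} {c B θ : ℝ}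
    (hc : 0 < c) (hM : ∀ v : Fin n → ℝ, c * ∑ i, v i ^ 2 ≤ v ⬝ᵥ (M *ᵥ v))
    (hband : ∀ i j : Fin n, w < (((i : ℕ) : ℤ) - ((j : ℕ) : ℤ)).natAbs → M i j = 0)
    (hB : ∀ i j, |M i j| ≤ B) (hθ : 1 ≤ θ)
    (hsmall : B * (θ ^ w - 1) * (2 * w + 1) ≤ c / 2) (j k : Fin n) :
    |M⁻¹ j k| ≤ 2 / c * θ⁻¹ ^ (((j : ℕ) : ℤ) - ((k : ℕ) : ℤ)).natAbs := by
  have hθ0 : 0 < θ := by linarith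
  have hθw : 1 ≤ θ ^ w := one_le_pow₀ hθ
  have hB0 : 0 ≤ B := (abs_nonneg _).trans (hB j j)
  set x : Fin n → ℝ := fun i => M⁻¹ i k with hx
  set d : Fin n → ℝ := fun i => θ ^ (((i : ℕ) : ℤ) - ((k : ℕ) : ℤ)).natAbs with hd
  have hdpos : ∀ i, 0 < d i := fun i => pow_pos hθ0 _
  have hdk : d k = 1 := by simp [hd]
  set y : Fin n → ℝ := fun i => d i * x i with hy
  set S : ℝ := ∑ i, y i ^ 2 with hS
  have hMx : ∀ i, ∑ l, M i l * x l = if i = k then 1 else 0 := by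
    intro i
    have h := congrFun (congrFun
      (Matrix.mul_nonsing_inv M ((Matrix.isUnit_iff_isUnit_det M).1 (isUnit_of_coercive hc hM))) i) k
    rwa [Matrix.mul_apply, Matrix.one_apply] at h
  have htest : ∑ i, ∑ l, d i * y i * (M i l * x l) = x k := by
    simp only [← Finset.mul_sum, hMx]
    simp [hy, hdk]
  have hdle : ∀ i l : Fin n, (((i : ℕ) : ℤ) - ((l : ℕ) : ℤ)).natAbs ≤ w → d i ≤ θ ^ w * d l := by
    intro i l h
    rw [hd, ← pow_add]
    exact pow_le_pow_right₀ hθ (by omega)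
  have hdiff : y ⬝ᵥ (M *ᵥ y) - x k ≤ B * (θ ^ w - 1) * ((2 * w + 1) * S) := by
    have h1 : y ⬝ᵥ (M *ᵥ y) - x k = ∑ i, ∑ l, y i * M i l * (d l - d i) * x l := by
      rw [← htest]
      simp only [dotProduct, Matrix.mulVec, Finset.mul_sum, ← Finset.sum_sub_distrib]
      refine Finset.sum_congr rfl fun i _ => Finset.sum_congr rfl fun l _ => ?_
      simp only [hy]
      ring
    rw [h1]
    refine le_trans ?_ (mul_le_mul_of_nonneg_left (sum_band_abs_mul_abs_le w y)
      (mul_nonneg hB0 (sub_nonneg.2 hθw)))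
    simp only [Finset.mul_sum]
    refine Finset.sum_le_sum fun i _ => Finset.sum_le_sum fun l _ => ?_
    split_ifs with h
    · have h2 : |d l - d i| ≤ (θ ^ w - 1) * d l := by
        rw [abs_sub_comm]
        refine abs_sub_le_of_le_mul (hdpos i).le (hdpos l).le (hdle i l h) (hdle l i ?_)
        rwa [← Int.natAbs_neg, neg_sub]
      calc y i * M i l * (d l - d i) * x l
          ≤ |y i * M i l * (d l - d i) * x l| := le_abs_self _
        _ = |y i| * |M i l| * |d l - d i| * |x l| := by simp only [abs_mul]
        _ ≤ |y i| * B * ((θ ^ w - 1) * d l) * |x l| := by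
            gcongr
            exact hB i l
        _ = B * (θ ^ w - 1) * (|y i| * |y l|) := by
            simp only [hy, abs_mul, abs_of_pos (hdpos l)]
            ring
    · rw [hband i l (by omega)]
      simp
  have hS0 : 0 ≤ S := Finset.sum_nonneg fun i _ => sq_nonneg _
  have hle : ∀ i, y i ^ 2 ≤ S := fun i =>
    Finset.single_le_sum (f := fun i => y i ^ 2) (fun i _ => sq_nonneg _) (Finset.mem_univ i)
  have h1 : c / 2 * S ≤ x k := by
    have := hM y
    nlinarith [mul_le_mul_of_nonneg_right hsmall hS0]
  have h2 : x k ^ 2 ≤ S := by simpa [hy, hdk] using hle k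
  have h3 : (c / 2) ^ 2 * S ≤ 1 := by
    by_contra! h
    have hSpos : 0 < S := by
      rcases hS0.eq_or_lt with h' | h'
      · rw [← h'] at h
        norm_num at h
      · exact h'
    have : (c / 2 * S) ^ 2 ≤ x k ^ 2 := pow_le_pow_left₀ (by positivity) h1 2
    nlinarith [mul_lt_mul_of_pos_right h hSpos]
  have h4 : |c / 2 * y j| ≤ 1 := by
    rw [← sq_le_one_iff_abs_le_one, mul_pow]
    exact (mul_le_mul_of_nonneg_left (hle j) (sq_nonneg _)).trans h3
  have h5 : |y j| = d j * |x j| := by simp only [hy, abs_mul, abs_of_pos (hdpos j)]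
  rw [abs_mul, abs_of_pos (half_pos hc), h5] at h4
  rw [inv_pow]
  change |x j| ≤ 2 / c * (d j)⁻¹
  rw [← div_eq_mul_inv, div_div, le_div_iff₀ (mul_pos hc (hdpos j))]
  linarith

/-- Cauchy–Schwarz in the inner product of a positive definite matrix. -/
lemma exists_sq_dotProduct_le_of_posDef {n : ℕ} {Q : Matrix (Fin n) (Fin n) ℝ} (hQ : Q.PosDef)
    (f : Fin n → ℝ) : ∃ κ : ℝ, 0 < κ ∧ ∀ x : Fin n → ℝ, (f ⬝ᵥ x) ^ 2 ≤ κ * (x ⬝ᵥ (Q *ᵥ x)) := by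
  have hnonneg : ∀ x : Fin n → ℝ, 0 ≤ x ⬝ᵥ (Q *ᵥ x) := fun x => by
    simpa using hQ.posSemidef.dotProduct_mulVec_nonneg x
  have hsymm : Qᵀ = Q := by
    have := hQ.isHermitian
    rwa [Matrix.IsHermitian, Matrix.conjTranspose_eq_transpose_of_trivial] at this
  set z := Q⁻¹ *ᵥ f
  have hz : Q *ᵥ z = f := by
    rw [Matrix.mulVec_mulVec, Matrix.mul_nonsing_inv _
      ((Matrix.isUnit_iff_isUnit_det Q).1 hQ.isUnit), Matrix.one_mulVec]
  have hzf : 0 ≤ z ⬝ᵥ f := by simpa [hz] using hnonneg z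
  refine ⟨z ⬝ᵥ f + 1, by linarith, fun x => ?_⟩
  set s := z ⬝ᵥ f + 1
  set p := f ⬝ᵥ x
  have h1 : z ⬝ᵥ (Q *ᵥ x) = p := by
    rw [Matrix.dotProduct_mulVec, ← Matrix.mulVec_transpose, hsymm, hz]
  have h := hnonneg (s • x - p • z)
  have h2 : x ⬝ᵥ f = p := dotProduct_comm _ _
  simp only [Matrix.mulVec_sub, Matrix.mulVec_smul, hz, sub_dotProduct, dotProduct_sub,
    smul_dotProduct, dotProduct_smul, smul_eq_mul, h1, h2] at h
  have hs : 0 < s := by linarith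
  have h3 : z ⬝ᵥ f = s - 1 := by simp [s]
  rw [h3] at h
  have h4 : 0 ≤ s * (s * (x ⬝ᵥ (Q *ᵥ x)) - p ^ 2) := by nlinarith [sq_nonneg p]
  linarith [nonneg_of_mul_nonneg_right h4 hs]

/-- The trajectory generated by the `j`-th column is the shifted reference trajectory. -/
lemma traj_colU {nx : ℕ} {A : Matrix (Fin nx) (Fin nx) ℝ} {b : Fin nx → ℝ}
    {xb : ℕ → Fin nx → ℝ} {ub : ℕ → ℝ} (hxb0 : xb 0 = 0)
    (hrec : ∀ i ≤ nx, xb (i + 1) = A *ᵥ xb i + ub i • b) (hend : xb (nx + 1) = 0) (j i : ℕ) :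
    traj A b (colU ub nx j) i = if j ≤ i ∧ i ≤ j + nx then xb (i - j) else 0 := by
  induction i with
  | zero =>
    rw [traj]
    split_ifs <;> simp [hxb0]
  | succ i ih =>
    rw [traj, ih, colU]
    by_cases h : j ≤ i ∧ i ≤ j + nx
    · rw [if_pos h, if_pos h, ← hrec _ (by omega)]
      by_cases h' : i = j + nx
      · rw [if_neg (by omega), show i - j + 1 = nx + 1 by omega, hend]
      · rw [if_pos (by omega), show i - j + 1 = i + 1 - j by omega]
    · rw [if_neg h, if_neg h]
      split_ifs with h'
      · rw [show i + 1 - j = 0 by omega, hxb0]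
        simp
      · simp

/-- The reference trajectory spans the state space, so that its inputs are given by a linear
(deadbeat) state feedback. -/
lemma exists_feedback {nx : ℕ} {A : Matrix (Fin nx) (Fin nx) ℝ} {b : Fin nx → ℝ}
    (hctrb : IsUnit (ctrbMat A b)) {xb : ℕ → Fin nx → ℝ} {ub : ℕ → ℝ} (hxb0 : xb 0 = 0)
    (hub0 : ub 0 = 1) (hrec : ∀ i ≤ nx, xb (i + 1) = A *ᵥ xb i + ub i • b) :
    ∃ f : Fin nx → ℝ, ∀ k < nx, f ⬝ᵥ xb (k + 1) = ub (k + 1) := by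
  have hform : ∀ k ≤ nx, xb (k + 1) = ∑ l ∈ Finset.range (k + 1), ub (k - l) • ((A ^ l) *ᵥ b) := by
    intro k
    induction k with
    | zero =>
      intro _
      rw [hrec 0 (Nat.zero_le _), hxb0]
      simp
    | succ k ih =>
      intro hk
      rw [hrec _ hk, ih (by omega), Finset.sum_range_succ' _ (k + 1), Matrix.mulVec_sum]
      congr 1
      · refine Finset.sum_congr rfl fun l _ => ?_
        rw [Matrix.mulVec_smul, Matrix.mulVec_mulVec, ← pow_succ', Nat.add_sub_add_right]
      · simp
  let T : Matrix (Fin nx) (Fin nx) ℝ :=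
    Matrix.of fun l k => if (l : ℕ) ≤ k then ub ((k : ℕ) - l) else 0
  let P : Matrix (Fin nx) (Fin nx) ℝ := Matrix.of fun a k => xb ((k : ℕ) + 1) a
  have hT : IsUnit T := by
    rw [Matrix.isUnit_iff_isUnit_det, Matrix.det_of_isUpperTriangular]
    · simp [T, hub0]
    · intro l k hlk
      have : (k : ℕ) < l := hlk
      simp only [T, Matrix.of_apply]
      rw [if_neg (by omega)]
  have hPT : P = ctrbMat A b * T := by
    ext a k
    simp only [P, T, ctrbMat, Matrix.mul_apply, Matrix.of_apply]
    rw [hform k k.2.le, Finset.sum_apply,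
      Fin.sum_univ_eq_sum_range
        (fun l => ((A ^ l) *ᵥ b) a * if l ≤ (k : ℕ) then ub ((k : ℕ) - l) else 0) nx]
    have hsub : Finset.range ((k : ℕ) + 1) ⊆ Finset.range nx :=
      Finset.range_subset_range.2 (by omega)
    rw [← Finset.sum_subset hsub]
    · refine Finset.sum_congr rfl fun l hl => ?_
      rw [Finset.mem_range] at hl
      rw [if_pos (by omega), Pi.smul_apply, smul_eq_mul, mul_comm]
    · intro l _ hl
      rw [Finset.mem_range] at hl
      rw [if_neg (by omega), mul_zero]
  have hP : IsUnit P := hPT ▸ hctrb.mul hT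
  refine ⟨(fun k : Fin nx => ub ((k : ℕ) + 1)) ᵥ* P⁻¹, fun k hk => ?_⟩
  have h : ((fun k : Fin nx => ub ((k : ℕ) + 1)) ᵥ* P⁻¹) ᵥ* P =
      fun k : Fin nx => ub ((k : ℕ) + 1) := by
    rw [Matrix.vecMul_vecMul, Matrix.nonsing_inv_mul _ ((Matrix.isUnit_iff_isUnit_det P).1 hP),
      Matrix.vecMul_one]
  exact congrFun h ⟨k, hk⟩

/-- The entries of the reduced Hessian are sums over the stages of the polarized stage costs. -/
lemma reducedHessian_apply (N nx : ℕ) (A : Matrix (Fin nx) (Fin nx) ℝ) (b : Fin nx → ℝ)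
    (Q : Matrix (Fin nx) (Fin nx) ℝ) (r : ℝ) (ub : ℕ → ℝ) (j k : Fin (N - 1)) :
    ((Zmat N nx A b ub)ᵀ * Hmat N nx Q r * Zmat N nx A b ub) j k =
      ∑ i ∈ Finset.range (N - 1),
        (traj A b (colU ub nx j) i ⬝ᵥ (Q *ᵥ traj A b (colU ub nx k) i)
          + r * (colU ub nx j i * colU ub nx k i)) := by
  rw [Matrix.mul_assoc, Matrix.mul_apply, Fintype.sum_sum_type, Finset.sum_add_distrib]
  congr 1
  · rw [Fintype.sum_prod_type]
    have hrow : ∀ (i : Fin N) (a : Fin nx),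
        (Hmat N nx Q r * Zmat N nx A b ub) (Sum.inl (i, a)) k =
          if (i : ℕ) + 1 < N then (Q *ᵥ traj A b (colU ub nx k) i) a else 0 := by
      intro i a
      rw [Matrix.mul_apply, Fintype.sum_sum_type, Fintype.sum_prod_type,
        Finset.sum_eq_single i]
      · simp only [Hmat, Zmat, true_and, zero_mul, Finset.sum_const_zero, add_zero]
        split_ifs <;> simp [Matrix.mulVec, dotProduct]
      · intro i' _ h
        simp [Hmat, h.symm]
      · simp
    simp only [Matrix.transpose_apply, hrow]
    rw [Finset.sum_congr rfl (g := fun i : Fin N => (fun i : ℕ => if i + 1 < N then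
      traj A b (colU ub nx j) i ⬝ᵥ (Q *ᵥ traj A b (colU ub nx k) i) else 0) i)
      (fun i _ => by simp only [Zmat]; split_ifs <;> simp [dotProduct]),
      Fin.sum_univ_eq_sum_range (fun i : ℕ => if i + 1 < N then
      traj A b (colU ub nx j) i ⬝ᵥ (Q *ᵥ traj A b (colU ub nx k) i) else 0)]
    cases N with
    | zero => exact j.elim0
    | succ n =>
      rw [Finset.sum_range_succ, if_neg (lt_irrefl _), add_zero]
      refine Finset.sum_congr rfl fun i hi => if_pos ?_
      rw [Finset.mem_range] at hi
      omega
  · rw [← Fin.sum_univ_eq_sum_range (fun i => r * (colU ub nx j i * colU ub nx k i))]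
    refine Finset.sum_congr rfl fun i _ => ?_
    rw [Matrix.transpose_apply, Matrix.mul_apply, Fintype.sum_sum_type,
      Finset.sum_eq_zero (fun p _ => by simp [Hmat]), zero_add, Finset.sum_eq_single i]
    · simp [Hmat, Zmat]
      ring
    · intro i' _ h
      simp [Hmat, h.symm]
    · simp

lemma reducedHessian_eq_zero_of_far {N nx : ℕ} {A : Matrix (Fin nx) (Fin nx) ℝ} {b : Fin nx → ℝ}
    {Q : Matrix (Fin nx) (Fin nx) ℝ} {r : ℝ} {xb : ℕ → Fin nx → ℝ} {ub : ℕ → ℝ} (hxb0 : xb 0 = 0)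
    (hrec : ∀ i ≤ nx, xb (i + 1) = A *ᵥ xb i + ub i • b) (hend : xb (nx + 1) = 0)
    (j k : Fin (N - 1)) (h : nx < (((j : ℕ) : ℤ) - ((k : ℕ) : ℤ)).natAbs) :
    ((Zmat N nx A b ub)ᵀ * Hmat N nx Q r * Zmat N nx A b ub) j k = 0 := by
  rw [reducedHessian_apply]
  refine Finset.sum_eq_zero fun i _ => ?_
  rw [traj_colU hxb0 hrec hend, traj_colU hxb0 hrec hend, colU, colU]
  by_cases hj : (j : ℕ) ≤ i ∧ i ≤ j + nx
  · have hk : ¬ ((k : ℕ) ≤ i ∧ i ≤ k + nx) := by omega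
    simp [hk]
  · simp [hj]

lemma exists_abs_reducedHessian_le {nx : ℕ} {A : Matrix (Fin nx) (Fin nx) ℝ} {b : Fin nx → ℝ}
    (Q : Matrix (Fin nx) (Fin nx) ℝ) (r : ℝ) {xb : ℕ → Fin nx → ℝ} {ub : ℕ → ℝ} (hxb0 : xb 0 = 0)
    (hrec : ∀ i ≤ nx, xb (i + 1) = A *ᵥ xb i + ub i • b) (hend : xb (nx + 1) = 0) :
    ∃ B : ℝ, ∀ (N : ℕ) (j k : Fin (N - 1)),
      |((Zmat N nx A b ub)ᵀ * Hmat N nx Q r * Zmat N nx A b ub) j k| ≤ B := by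
  let g : ℕ → ℕ → ℝ := fun s t => |xb s ⬝ᵥ (Q *ᵥ xb t) + r * (ub s * ub t)|
  let G : ℝ := ∑ s ∈ Finset.range (nx + 1), ∑ t ∈ Finset.range (nx + 1), g s t
  have hg : ∀ s t, 0 ≤ g s t := fun s t => abs_nonneg _
  have hgG : ∀ s ≤ nx, ∀ t ≤ nx, g s t ≤ G := by
    intro s hs t ht
    have hs' : s ∈ Finset.range (nx + 1) := Finset.mem_range.2 (by omega)
    have ht' : t ∈ Finset.range (nx + 1) := Finset.mem_range.2 (by omega)
    exact (Finset.single_le_sum (f := fun t => g s t) (fun t _ => hg s t) ht').trans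
      (Finset.single_le_sum (f := fun s => ∑ t ∈ Finset.range (nx + 1), g s t)
        (fun s _ => Finset.sum_nonneg fun t _ => hg s t) hs')
  have hG : 0 ≤ G := Finset.sum_nonneg fun s _ => Finset.sum_nonneg fun t _ => hg s t
  refine ⟨(nx + 1) * G, fun N j k => ?_⟩
  rw [reducedHessian_apply]
  refine (Finset.abs_sum_le_sum_abs _ _).trans ?_
  calc _ ≤ ∑ i ∈ Finset.range (N - 1), (if (j : ℕ) ≤ i ∧ i ≤ j + nx then G else 0) := by
        refine Finset.sum_le_sum fun i _ => ?_
        rw [traj_colU hxb0 hrec hend, traj_colU hxb0 hrec hend, colU, colU]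
        by_cases hj : (j : ℕ) ≤ i ∧ i ≤ j + nx
        · by_cases hk : (k : ℕ) ≤ i ∧ i ≤ k + nx
          · simp only [if_pos hj, if_pos hk]
            exact hgG _ (by omega) _ (by omega)
          · simpa [hj, hk] using hG
        · simp [hj]
    _ ≤ (nx + 1) * G := by
        rw [← Finset.sum_filter, Finset.sum_const, nsmul_eq_mul]
        gcongr
        calc (((Finset.range (N - 1)).filter (fun i => (j : ℕ) ≤ i ∧ i ≤ j + nx)).card : ℝ)
            ≤ ((Finset.Icc (j : ℕ) (j + nx)).card : ℝ) := by
              exact_mod_cast Finset.card_le_card fun i hi =>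
                Finset.mem_Icc.2 (Finset.mem_filter.1 hi).2
          _ = nx + 1 := by
              rw [Nat.card_Icc, show (j : ℕ) + nx + 1 - j = nx + 1 by omega]
              push_cast
              rfl

lemma exists_reducedHessian_coercive {nx : ℕ} {A : Matrix (Fin nx) (Fin nx) ℝ} {b : Fin nx → ℝ}
    (hctrb : IsUnit (ctrbMat A b)) {Q : Matrix (Fin nx) (Fin nx) ℝ} (hQ : Q.PosDef) {r : ℝ}
    (hr : 0 < r) {xb : ℕ → Fin nx → ℝ} {ub : ℕ → ℝ} (hxb0 : xb 0 = 0) (hub0 : ub 0 = 1)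
    (hrec : ∀ i ≤ nx, xb (i + 1) = A *ᵥ xb i + ub i • b) (hend : xb (nx + 1) = 0) :
    ∃ c : ℝ, 0 < c ∧ ∀ (N : ℕ) (v : Fin (N - 1) → ℝ), c * ∑ i, v i ^ 2 ≤
      v ⬝ᵥ (((Zmat N nx A b ub)ᵀ * Hmat N nx Q r * Zmat N nx A b ub) *ᵥ v) := by
  obtain ⟨f, hf⟩ := exists_feedback hctrb hxb0 hub0 hrec
  obtain ⟨κ, hκ, hκle⟩ := exists_sq_dotProduct_le_of_posDef hQ f
  have hK : 0 < 2 / r + 2 * κ := by positivity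
  refine ⟨(2 / r + 2 * κ)⁻¹, inv_pos.2 hK, fun N v => ?_⟩
  have hcol : ∀ j i : ℕ, colU ub nx j i =
      (if j = i then 1 else 0) + f ⬝ᵥ traj A b (colU ub nx j) i := by
    intro j i
    rw [traj_colU hxb0 hrec hend, colU]
    by_cases h : j ≤ i ∧ i ≤ j + nx
    · rw [if_pos h, if_pos h]
      by_cases hji : j = i
      · subst hji
        simp [hub0, hxb0]
      · rw [if_neg hji, zero_add, show i - j = (i - j - 1) + 1 by omega, hf _ (by omega)]
    · rw [if_neg h, if_neg h, if_neg (by omega)]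
      simp
  let X : ℕ → Fin nx → ℝ := fun i => ∑ j : Fin (N - 1), v j • traj A b (colU ub nx j) i
  let U : ℕ → ℝ := fun i => ∑ j : Fin (N - 1), v j * colU ub nx j i
  have hform : v ⬝ᵥ (((Zmat N nx A b ub)ᵀ * Hmat N nx Q r * Zmat N nx A b ub) *ᵥ v)
      = ∑ i : Fin (N - 1), (X i ⬝ᵥ (Q *ᵥ X i) + r * U i ^ 2) := by
    let t : ℕ → Fin (N - 1) → Fin (N - 1) → ℝ := fun i j k =>
      traj A b (colU ub nx j) i ⬝ᵥ (Q *ᵥ traj A b (colU ub nx k) i)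
        + r * (colU ub nx j i * colU ub nx k i)
    calc _ = ∑ j, ∑ k, ∑ i : Fin (N - 1), v j * (t i j k * v k) := by
          simp only [dotProduct, Matrix.mulVec, Finset.mul_sum]
          refine Finset.sum_congr rfl fun j _ => Finset.sum_congr rfl fun k _ => ?_
          rw [reducedHessian_apply, ← Finset.mul_sum, ← Finset.sum_mul,
            ← Fin.sum_univ_eq_sum_range (fun i => t i j k)]
      _ = ∑ i : Fin (N - 1), ∑ j, ∑ k, v j * (t i j k * v k) := by
          rw [Finset.sum_congr rfl fun j _ => Finset.sum_comm]
          exact Finset.sum_comm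
      _ = _ := by
          refine Finset.sum_congr rfl fun i _ => ?_
          have hX : X i ⬝ᵥ (Q *ᵥ X i) = ∑ j, ∑ k, v j * (v k *
              (traj A b (colU ub nx j) i ⬝ᵥ (Q *ᵥ traj A b (colU ub nx k) i))) := by
            simp only [X, Matrix.mulVec_sum, Matrix.mulVec_smul]
            rw [sum_dotProduct]
            refine Finset.sum_congr rfl fun j _ => ?_
            rw [smul_dotProduct, dotProduct_sum, smul_eq_mul, Finset.mul_sum]
            simp only [dotProduct_smul, smul_eq_mul]
          have hU : U i ^ 2 = ∑ j, ∑ k, v j * colU ub nx j i * (v k * colU ub nx k i) := by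
            rw [sq, Finset.sum_mul_sum]
          rw [hX, hU]
          simp only [Finset.mul_sum, ← Finset.sum_add_distrib]
          refine Finset.sum_congr rfl fun j _ => Finset.sum_congr rfl fun k _ => ?_
          simp only [t]
          ring
  have hv : ∀ i : Fin (N - 1), v i = U i - f ⬝ᵥ X i := by
    intro i
    simp only [U, X, dotProduct_sum, dotProduct_smul, smul_eq_mul, ← Finset.sum_sub_distrib]
    rw [Finset.sum_congr rfl (g := fun j => if j = i then v j else 0)]
    · simp
    · intro j _
      rw [hcol, ← mul_sub, add_sub_cancel_right]
      simp [Fin.ext_iff]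
  rw [hform, Finset.mul_sum]
  refine Finset.sum_le_sum fun i _ => ?_
  rw [inv_mul_le_iff₀ hK, hv i]
  have h1 := hκle (X i)
  have h2 : 0 ≤ X i ⬝ᵥ (Q *ᵥ X i) := nonneg_of_mul_nonneg_right ((sq_nonneg _).trans h1) hκ
  have h3 : (2 / r + 2 * κ) * (X i ⬝ᵥ (Q *ᵥ X i) + r * U i ^ 2) =
      2 / r * (X i ⬝ᵥ (Q *ᵥ X i)) + 2 * U i ^ 2 + 2 * (κ * (X i ⬝ᵥ (Q *ᵥ X i)))
        + 2 * κ * r * U i ^ 2 := by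
    field_simp
    ring
  rw [h3]
  have h4 : 0 ≤ 2 / r * (X i ⬝ᵥ (Q *ᵥ X i)) := by positivity
  have h5 : 0 ≤ 2 * κ * r * U i ^ 2 := by positivity
  nlinarith [sq_nonneg (U i + f ⬝ᵥ X i)]

lemma exists_one_lt_mul_pow_sub_one_le (B : ℝ) (w : ℕ) {ε : ℝ} (hε : 0 < ε) :
    ∃ θ : ℝ, 1 < θ ∧ B * (θ ^ w - 1) * (2 * w + 1) ≤ ε := by
  have hcont : ContinuousAt (fun θ : ℝ => B * (θ ^ w - 1) * (2 * w + 1)) 1 := by fun_prop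
  have hev := hcont.eventually_lt (continuousAt_const (y := ε)) (by simpa using hε)
  obtain ⟨θ, h, h1⟩ := ((hev.filter_mono nhdsWithin_le_nhds).and
    (self_mem_nhdsWithin (s := Set.Ioi (1 : ℝ)))).exists
  exact ⟨θ, h1, h.le⟩

/-- uniform exponential off-diagonal decay of the inverse reduced
Hessian: there are `C > 0` and `ρ ∈ [0,1)`, independent of `N`, such that `ZᵀHZ` is
invertible and `|((ZᵀHZ)⁻¹)_{j,k}| ≤ C ρ^{|j−k|}` for all `N ≥ 2`. -/
theorem inverse_reduced_hessian_exponential_decay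
    (nx : ℕ) (hnx : 1 ≤ nx)
    (A : Matrix (Fin nx) (Fin nx) ℝ) (b : Fin nx → ℝ) (hctrb : IsUnit (ctrbMat A b))
    (Q : Matrix (Fin nx) (Fin nx) ℝ) (hQ : Q.PosDef) (r : ℝ) (hr : 0 < r)
    (xb : ℕ → Fin nx → ℝ) (ub : ℕ → ℝ)
    (hxb0 : xb 0 = 0) (hub0 : ub 0 = 1)
    (hrec : ∀ i ≤ nx, xb (i + 1) = A *ᵥ xb i + ub i • b)
    (hend : xb (nx + 1) = 0) :
    ∃ C : ℝ, 0 < C ∧ ∃ ρ : ℝ, 0 ≤ ρ ∧ ρ < 1 ∧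
      ∀ N : ℕ, 2 ≤ N →
        IsUnit ((Zmat N nx A b ub)ᵀ * Hmat N nx Q r * Zmat N nx A b ub) ∧
        ∀ j k : Fin (N - 1),
          |((Zmat N nx A b ub)ᵀ * Hmat N nx Q r * Zmat N nx A b ub)⁻¹ j k| ≤
            C * ρ ^ (((j : ℕ) : ℤ) - ((k : ℕ) : ℤ)).natAbs := by
  obtain ⟨c, hc, hcoer⟩ := exists_reducedHessian_coercive hctrb hQ hr hxb0 hub0 hrec hend
  obtain ⟨B, hB⟩ := exists_abs_reducedHessian_le Q r hxb0 hrec hend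
  obtain ⟨θ, hθ, hsmall⟩ := exists_one_lt_mul_pow_sub_one_le B nx (half_pos hc)
  refine ⟨2 / c, by positivity, θ⁻¹, by positivity, inv_lt_one_of_one_lt₀ hθ, fun N _ => ?_⟩
  exact ⟨isUnit_of_coercive hc (hcoer N),
    abs_inv_le_of_coercive_of_banded hc (hcoer N)
      (reducedHessian_eq_zero_of_far hxb0 hrec hend) (hB N) hθ.le hsmall⟩
end
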